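/- arXiv:2105.13184 — 2 statements merged into one kernel-verified Lean document; each statement's English description precedes it below -/
import Mathlib

section
/- Let a > 0, K_s > 0, Δt > 0 and c > 0. Then there exists a unique real number x > c satisfying the implicit Green–Ampt update equation x = c + K_s Δt + a · ln( (a + x) / (a + c) ); moreover every real solution x > 0 of this equation satisfies x > c + K_s Δt. -/
theorem ga_key (a x y : ℝ) (ha : 0 < a) (hx : 0 < x) (hxy : x < y) :
    a * Real.log ((a + y) / (a + x)) ≤ a * ((y - x) / (a + x)) ∧
    a * Real.log ((a + y) / (a + x)) < y - x := by
  have hax : 0 < a + x := by linarith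
  have hay : 0 < a + y := by linarith
  have h1 : Real.log ((a + y) / (a + x)) ≤ (y - x) / (a + x) := by
    have h := Real.log_le_sub_one_of_pos (div_pos hay hax)
    have e : (a + y) / (a + x) - 1 = (y - x) / (a + x) := by
      field_simp
      ring
    linarith
  have h2 := mul_le_mul_of_nonneg_left h1 ha.le
  refine ⟨h2, lt_of_le_of_lt h2 ?_⟩
  rw [← mul_div_assoc, div_lt_iff₀ hax]
  nlinarith [mul_pos (sub_pos.2 hxy) hx]

/-- The implicit Green–Ampt update equation
`x = c + K_s Δt + a·ln((a + x)/(a + c))` has a unique solution `x > c`,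
and every positive solution satisfies `x > c + K_s Δt`. -/
theorem greenAmpt_implicit_update_unique_solution
    (a Ks Δt c : ℝ) (ha : 0 < a) (hKs : 0 < Ks) (hΔt : 0 < Δt) (hc : 0 < c) :
    (∃! x : ℝ, c < x ∧ x = c + Ks * Δt + a * Real.log ((a + x) / (a + c))) ∧
    (∀ x : ℝ, 0 < x → x = c + Ks * Δt + a * Real.log ((a + x) / (a + c)) →
      c + Ks * Δt < x) := by
  have hK : 0 < Ks * Δt := mul_pos hKs hΔt
  have hac : 0 < a + c := by linarith
  have mono : ∀ x y : ℝ, 0 < x → x < y →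
      x - a * Real.log ((a + x) / (a + c)) < y - a * Real.log ((a + y) / (a + c)) := by
    intro x y hx hxy
    have h := (ga_key a x y ha hx hxy).2
    have hax : a + x ≠ 0 := by linarith
    have hay : a + y ≠ 0 := by linarith
    rw [Real.log_div hay hax] at h
    rw [Real.log_div hay hac.ne', Real.log_div hax hac.ne']
    linarith
  have hcc : c - a * Real.log ((a + c) / (a + c)) = c := by
    rw [div_self hac.ne']; simp
  refine ⟨?_, ?_⟩
  · set B := c + Ks * Δt * (a + c) / c with hB
    have hcB : c < B := by
      have : 0 < Ks * Δt * (a + c) / c := by positivity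
      linarith
    have hcont : ContinuousOn (fun x => x - a * Real.log ((a + x) / (a + c))) (Set.Icc c B) := by
      refine continuousOn_id.sub (continuousOn_const.mul (ContinuousOn.log (by fun_prop) ?_))
      intro x hx
      have : 0 < a + x := by linarith [hx.1]
      positivity
    have hend : c + Ks * Δt ≤ B - a * Real.log ((a + B) / (a + c)) := by
      have h := (ga_key a c B ha hc hcB).1
      have e : B - a * ((B - c) / (a + c)) = c + Ks * Δt := by
        rw [hB]
        field_simp
        ring
      linarith
    obtain ⟨x, hx, hxe⟩ := intermediate_value_Icc hcB.le hcont
      (show c + Ks * Δt ∈ _ from ⟨by simp only [hcc]; linarith, hend⟩)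
    simp only at hxe
    refine ⟨x, ⟨lt_of_le_of_ne hx.1 ?_, by linarith⟩, ?_⟩
    · rintro rfl
      linarith
    · rintro y ⟨hy, hye⟩
      rcases lt_trichotomy y x with h | h | h
      · have := mono y x (by linarith) h
        linarith
      · exact h
      · have := mono x y (by linarith [hx.1]) h
        linarith
  · intro x hx hxe
    have hcx : c < x := by
      by_contra h
      rcases (not_lt.1 h).lt_or_eq with h | h
      · have := mono x c hx h
        linarith
      · subst h
        linarith
    have : 0 < Real.log ((a + x) / (a + c)) :=
      Real.log_pos (by rw [lt_div_iff₀ hac]; linarith)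
    have := mul_pos ha this
    linarith
end

section
/- Consider a two-layer soil with upper-layer thickness d₁ > 0 and hydraulic conductivities K₁, K₂ > 0, lower-layer moisture deficit Δθ₂ > 0, and let ψ + h_p > 0. Let t₀ < t₁ and suppose the wetting-front depth d_f : ℝ → ℝ is differentiable on [t₀, t₁] with d_f(s) > d₁ for all s, and satisfies Δθ₂ · d_f'(s) = K_e(s) · ( (ψ + h_p)/d_f(s) + 1 ), where the effective hydraulic conductivity is K_e(s) = d_f(s) / ( d₁/K₁ + (d_f(s) − d₁)/K₂ ). Set I_c(s) = Δθ₂ · d_f(s) and A = Δθ₂ ( ψ + h_p − d₁ (K₂/K₁ − 1) ). Then I_c(t₁) = I_c(t₀) + K₂ (t₁ − t₀) + A · ln( (Δθ₂(ψ + h_p) + I_c(t₁)) / (Δθ₂(ψ + h_p) + I_c(t₀)) ). -/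
/-- Two-layer Green–Ampt model. When the wetting front `d_f` stays below
the upper layer (`d_f > d₁`) on `[t₀, t₁]` and evolves by
`Δθ₂ d_f' = K_e ((ψ + h_p)/d_f + 1)` with effective conductivity
`K_e = d_f / (d₁/K₁ + (d_f − d₁)/K₂)`, then the cumulative infiltration
`I_c = Δθ₂ d_f` satisfies the implicit integrated relation with the
lower-layer conductivity `K₂` and constant
`A = Δθ₂ (ψ + h_p − d₁ (K₂/K₁ − 1))`. -/
theorem twoLayer_greenAmpt_integrated_relation
    (d₁ K₁ K₂ Δθ₂ ψ hp t₀ t₁ : ℝ)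
    (hd₁ : 0 < d₁) (hK₁ : 0 < K₁) (hK₂ : 0 < K₂) (hΔθ₂ : 0 < Δθ₂)
    (hψhp : 0 < ψ + hp) (ht : t₀ < t₁)
    (df : ℝ → ℝ)
    (hdf : ∀ s ∈ Set.Icc t₀ t₁, d₁ < df s)
    (hode : ∀ s ∈ Set.Icc t₀ t₁, ∃ d' : ℝ, HasDerivAt df d' s ∧
      Δθ₂ * d' = (df s / (d₁ / K₁ + (df s - d₁) / K₂)) * ((ψ + hp) / df s + 1)) :
    Δθ₂ * df t₁ = Δθ₂ * df t₀ + K₂ * (t₁ - t₀)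
      + (Δθ₂ * (ψ + hp - d₁ * (K₂ / K₁ - 1)))
        * Real.log ((Δθ₂ * (ψ + hp) + Δθ₂ * df t₁)
          / (Δθ₂ * (ψ + hp) + Δθ₂ * df t₀)) := by
  have hder : ∀ s ∈ Set.Icc t₀ t₁, HasDerivAt (fun s => Δθ₂ * df s - K₂ * s
      - (Δθ₂ * (ψ + hp - d₁ * (K₂ / K₁ - 1))) * Real.log (ψ + hp + df s)) 0 s := by
    intro s hs
    obtain ⟨d', hd, he⟩ := hode s hs
    have h1 := hdf s hs
    have hpos : 0 < df s := hd₁.trans h1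
    have hP : 0 < ψ + hp + df s := by linarith
    have hq : 0 < d₁ / K₁ + (df s - d₁) / K₂ := by
      have : 0 < df s - d₁ := by linarith
      positivity
    have h2 := ((hd.const_mul Δθ₂).sub ((hasDerivAt_id s).const_mul K₂)).sub
      (((hd.const_add (ψ + hp)).log hP.ne').const_mul (Δθ₂ * (ψ + hp - d₁ * (K₂ / K₁ - 1))))
    refine h2.congr_deriv ?_
    have e1 : Δθ₂ * d' * (d₁ / K₁ + (df s - d₁) / K₂) = ψ + hp + df s := by
      rw [he, div_mul_eq_mul_div, div_mul_cancel₀ _ hq.ne', mul_add,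
        mul_div_cancel₀ _ hpos.ne', mul_one]
    have e2 : Δθ₂ * d' * (d₁ * (K₂ / K₁) + (df s - d₁)) = K₂ * (ψ + hp + df s) := by
      rw [← e1]; field_simp
    have e3 : K₂ = Δθ₂ * d' * (d₁ * (K₂ / K₁) + (df s - d₁)) / (ψ + hp + df s) := by
      rw [e2, mul_div_cancel_right₀ _ hP.ne']
    have e4 : Δθ₂ * d' = Δθ₂ * d' * (ψ + hp + df s) / (ψ + hp + df s) := by
      rw [mul_div_cancel_right₀ _ hP.ne']
    rw [mul_one]
    linear_combination e4 - e3
  have hc := constant_of_has_deriv_right_zero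
    (fun s hs => (hder s hs).continuousAt.continuousWithinAt)
    (fun s hs => (hder s (Set.Ico_subset_Icc_self hs)).hasDerivWithinAt)
    t₁ (Set.right_mem_Icc.2 ht.le)
  have p0 : 0 < ψ + hp + df t₀ := by linarith [hdf t₀ (Set.left_mem_Icc.2 ht.le)]
  have p1 : 0 < ψ + hp + df t₁ := by linarith [hdf t₁ (Set.right_mem_Icc.2 ht.le)]
  rw [← mul_add, ← mul_add, mul_div_mul_left _ _ hΔθ₂.ne', Real.log_div p1.ne' p0.ne']
  linear_combination hc
end
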